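/- The product of two core-compact topological spaces is core-compact: if X and Y are core-compact, then X × Y with the product topology is core-compact. -/

import Mathlib

/-- `S` is way below `T`: every family of open sets whose union contains `T`
admits a finite subfamily whose union contains `S`. -/
def WayBelow {X : Type} [TopologicalSpace X] (S T : Set X) : Prop :=
  ∀ (ι : Type) (U : ι → Set X), (∀ i, IsOpen (U i)) → T ⊆ ⋃ i, U i →
    ∃ J : Finset ι, S ⊆ ⋃ i ∈ J, U i

/-- A topological space is core-compact if every open neighbourhood of a point
contains an open neighbourhood of that point which is way below it. -/
def IsCoreCompact (X : Type) [TopologicalSpace X] : Prop :=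
  ∀ (x : X) (U : Set X), IsOpen U → x ∈ U →
    ∃ V : Set X, IsOpen V ∧ x ∈ V ∧ WayBelow V U

/-- A product of two way-below relations is a way-below relation in the product space. -/
theorem WayBelow.prod {X Y : Type} [TopologicalSpace X] [TopologicalSpace Y]
    {S U : Set X} {T W : Set Y} (hS : WayBelow S U) (hT : WayBelow T W) :
    WayBelow (S ×ˢ T) (U ×ˢ W) := by
  classical
  intro ι O hO hcover
  have tube : ∀ x : U, ∃ A : Set X, IsOpen A ∧ x.1 ∈ A ∧
      ∃ J : Finset ι, A ×ˢ T ⊆ ⋃ i ∈ J, O i := by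
    intro x
    have box : ∀ y : W, ∃ i, ∃ A : Set X, ∃ B : Set Y, IsOpen A ∧ IsOpen B ∧
        x.1 ∈ A ∧ y.1 ∈ B ∧ A ×ˢ B ⊆ O i := by
      intro y
      obtain ⟨i, hi⟩ := Set.mem_iUnion.1 (hcover (Set.mk_mem_prod x.2 y.2))
      exact ⟨i, isOpen_prod_iff.1 (hO i) _ _ hi⟩
    choose i A B hA hB hxA hyB hAB using box
    obtain ⟨K, hK⟩ := hT W B hB fun y hy => Set.mem_iUnion.2 ⟨⟨y, hy⟩, hyB _⟩
    refine ⟨⋂ y ∈ K, A y, isOpen_biInter_finset fun y _ => hA y,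
      Set.mem_iInter₂.2 fun y _ => hxA y, K.image i, ?_⟩
    rintro ⟨a, b⟩ ⟨ha, hb⟩
    obtain ⟨y, hy, hby⟩ := Set.mem_iUnion₂.1 (hK hb)
    exact Set.mem_iUnion₂.2 ⟨i y, Finset.mem_image_of_mem i hy,
      hAB y ⟨Set.mem_iInter₂.1 ha y hy, hby⟩⟩
  choose A hA hxA J hJ using tube
  obtain ⟨K, hK⟩ := hS U A hA fun x hx => Set.mem_iUnion.2 ⟨⟨x, hx⟩, hxA _⟩
  refine ⟨K.biUnion J, ?_⟩
  rintro ⟨a, b⟩ ⟨ha, hb⟩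
  obtain ⟨x, hx, hax⟩ := Set.mem_iUnion₂.1 (hK ha)
  obtain ⟨i, hi, hab⟩ := Set.mem_iUnion₂.1 (hJ x ⟨hax, hb⟩)
  exact Set.mem_iUnion₂.2 ⟨i, Finset.mem_biUnion.2 ⟨x, hx, hi⟩, hab⟩

theorem WayBelow.mono_right {X : Type} [TopologicalSpace X] {S T T' : Set X}
    (h : WayBelow S T) (hT : T ⊆ T') : WayBelow S T' :=
  fun ι U hU hcover => h ι U hU (hT.trans hcover)

theorem isCoreCompact_prod {X Y : Type} [TopologicalSpace X] [TopologicalSpace Y]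
    (hX : IsCoreCompact X) (hY : IsCoreCompact Y) : IsCoreCompact (X × Y) := by
  rintro ⟨x, y⟩ O hO hxy
  obtain ⟨U, W, hU, hW, hx, hy, hUW⟩ := isOpen_prod_iff.1 hO x y hxy
  obtain ⟨S, hS, hxS, hSU⟩ := hX x U hU hx
  obtain ⟨T, hT, hyT, hTW⟩ := hY y W hW hy
  exact ⟨S ×ˢ T, hS.prod hT, ⟨hxS, hyT⟩, (hSU.prod hTW).mono_right hUW⟩
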